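/- Let d ≥ 2 be an integer, let F : (0,∞) → ℝ be a smooth function with F′(α) = α^{−d/2} for all α > 0, and define g(α) := F(α) + (F(1) − F(α))/(1 − α) for α > 0, α ≠ 1 (so g(α) = F(α) + F^{[1]}(1,α)). Then for all α, β > 0 with α ≠ 1, β ≠ 1 and α ≠ β: (β/α)^{1/2} · ( (4/d)·α·F^{[4]}(α,α,1,1,β) + (2 + 4/d)·α·F^{[3]}(α,α,1,β) + (8/d)·α²·F^{[4]}(α,α,α,1,β) ) = −(4/d)·(α·β)^{1/2}·g^{[3]}(α,α,β,β). -/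

import Mathlib

/-- First divided difference `h^[1](a,b)` at distinct points. -/
noncomputable def dd1 (h : ℝ → ℝ) (a b : ℝ) : ℝ := (h a - h b) / (a - b)

/-- Divided difference `h^[2](a,a,b)` (using `h^[1](a,a) = h'(a)`). -/
noncomputable def dd2aab (h : ℝ → ℝ) (a b : ℝ) : ℝ := (deriv h a - dd1 h a b) / (a - b)

/-- Divided difference `h^[2](a,b,b)`. -/
noncomputable def dd2abb (h : ℝ → ℝ) (a b : ℝ) : ℝ := (dd1 h a b - deriv h b) / (a - b)

/-- Divided difference `h^[2](a,b,c)` with `a ≠ c`. -/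
noncomputable def dd2abc (h : ℝ → ℝ) (a b c : ℝ) : ℝ := (dd1 h a b - dd1 h b c) / (a - c)

/-- Divided difference `h^[3](a,a,a,b)` (using `h^[2](a,a,a) = h''(a)/2`). -/
noncomputable def dd3aaab (h : ℝ → ℝ) (a b : ℝ) : ℝ :=
  (deriv (deriv h) a / 2 - dd2aab h a b) / (a - b)

/-- Divided difference `h^[3](a,a,b,b)`. -/
noncomputable def dd3aabb (h : ℝ → ℝ) (a b : ℝ) : ℝ := (dd2aab h a b - dd2abb h a b) / (a - b)

/-- Divided difference `h^[3](a,a,c,b)`. -/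
noncomputable def dd3aacb (h : ℝ → ℝ) (a c b : ℝ) : ℝ :=
  (dd2aab h a c - dd2abc h a c b) / (a - b)

/-- Divided difference `h^[3](a,c,c,b)`. -/
noncomputable def dd3accb (h : ℝ → ℝ) (a c b : ℝ) : ℝ :=
  (dd2abb h a c - dd2aab h c b) / (a - b)

/-- Divided difference `h^[4](a,a,c,c,b)`. -/
noncomputable def dd4aaccb (h : ℝ → ℝ) (a c b : ℝ) : ℝ :=
  (dd3aabb h a c - dd3accb h a c b) / (a - b)

/-- Divided difference `h^[4](a,a,a,c,b)`. -/
noncomputable def dd4aaacb (h : ℝ → ℝ) (a c b : ℝ) : ℝ :=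
  (dd3aaab h a c - dd3aacb h a c b) / (a - b)

open Set

/-- An antiderivative `F` of `x ^ (-s)` on `(0, ∞)` satisfies
`x * F' x = 1 + (1 - s) * (F x - F 1)`, including the logarithmic case `s = 1`. -/
lemma mul_rpow_neg_eq_of_hasDerivAt {s : ℝ} {F : ℝ → ℝ}
    (hF : ∀ x : ℝ, 0 < x → HasDerivAt F (x ^ (-s)) x) {x : ℝ} (hx : 0 < x) :
    x * x ^ (-s) = 1 + (1 - s) * (F x - F 1) := by
  have hderiv : ∀ y ∈ Ioi (0 : ℝ),
      HasDerivAt (fun y => y * y ^ (-s) - (1 - s) * F y) 0 y := by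
    intro y hy
    have hy0 : (0 : ℝ) < y := hy
    have h := ((hasDerivAt_id y).mul (Real.hasDerivAt_rpow_const (p := -s) (Or.inl hy0.ne'))).sub
      ((hF y hy0).const_mul (1 - s))
    refine h.congr_deriv ?_
    rw [Real.rpow_sub_one hy0.ne', id]
    field_simp
    ring
  have hconst := isOpen_Ioi.is_const_of_deriv_eq_zero (convex_Ioi (0 : ℝ)).isPreconnected
    (fun y hy => (hderiv y hy).differentiableAt.differentiableWithinAt)
    (fun y hy => (hderiv y hy).deriv) (mem_Ioi.2 hx) (mem_Ioi.2 one_pos)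
  simp only [Real.one_rpow] at hconst
  linarith

/-- The second derivative of an antiderivative of `x ^ (-s)`. -/
lemma deriv_deriv_of_hasDerivAt_rpow {s : ℝ} {F : ℝ → ℝ}
    (hF : ∀ x : ℝ, 0 < x → HasDerivAt F (x ^ (-s)) x) {x : ℝ} (hx : 0 < x) :
    deriv (deriv F) x = -s * x ^ (-s) / x := by
  have hev : deriv F =ᶠ[nhds x] fun y => y ^ (-s) := by
    filter_upwards [Ioi_mem_nhds hx] with y hy using (hF y hy).deriv
  rw [hev.deriv_eq, (Real.hasDerivAt_rpow_const (p := -s) (Or.inl hx.ne')).deriv,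
    Real.rpow_sub_one hx.ne', mul_div_assoc]

/-- The derivative of `F + F^[1](1, ·)` away from `1`. -/
lemma hasDerivAt_add_divided_difference {F : ℝ → ℝ} {p x : ℝ} (hF : HasDerivAt F p x)
    (hx : x ≠ 1) :
    HasDerivAt (fun y => F y + (F 1 - F y) / (1 - y))
      (p + (-p * (1 - x) + (F 1 - F x)) / (1 - x) ^ 2) x := by
  have h := hF.add ((hF.const_sub (F 1)).div ((hasDerivAt_id x).const_sub 1)
    (sub_ne_zero.2 hx.symm))
  refine h.congr_deriv ?_
  simp only [id]
  ring

/-- Let `F` be smooth on `(0,∞)` with `F′(α) = α^{−d/2}` (`d ≥ 2`), and let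
`g(α) := F(α) + (F(1) − F(α))/(1 − α)`. Then for `α, β > 0` with `α ≠ 1`, `β ≠ 1`, `α ≠ β`:
`(β/α)^{1/2}·((4/d)·α·F^[4](α,α,1,1,β) + (2+4/d)·α·F^[3](α,α,1,β) + (8/d)·α²·F^[4](α,α,α,1,β))
  = −(4/d)·(αβ)^{1/2}·g^[3](α,α,β,β)`. -/
theorem stmt_10 (d : ℕ) (hd : 2 ≤ d) (F : ℝ → ℝ)
    (hFsmooth : ContDiffOn ℝ (⊤ : ℕ∞) F (Set.Ioi 0))
    (hF : ∀ x : ℝ, 0 < x → HasDerivAt F (x ^ (-(d : ℝ) / 2)) x)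
    (α β : ℝ) (hα : 0 < α) (hβ : 0 < β) (hα1 : α ≠ 1) (hβ1 : β ≠ 1) (hne : α ≠ β) :
    Real.sqrt (β / α) *
        (4 / (d : ℝ) * α * dd4aaccb F α 1 β + (2 + 4 / (d : ℝ)) * α * dd3aacb F α 1 β +
          8 / (d : ℝ) * α ^ 2 * dd4aaacb F α 1 β)
      = -(4 / (d : ℝ)) * Real.sqrt (α * β) *
          dd3aabb (fun x => F x + (F 1 - F x) / (1 - x)) α β := by
  have hF' : ∀ x : ℝ, 0 < x → HasDerivAt F (x ^ (-((d : ℝ) / 2))) x := by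
    simpa only [neg_div] using hF
  have hd0 : (d : ℝ) ≠ 0 := by positivity
  have hsqrt : Real.sqrt (β / α) = Real.sqrt (α * β) / α := by
    rw [show β / α = α * β / α ^ 2 by field_simp, Real.sqrt_div (by positivity),
      Real.sqrt_sq hα.le]
  have hFα : deriv F α = (1 + (1 - (d : ℝ) / 2) * (F α - F 1)) / α := by
    rw [(hF' α hα).deriv, eq_div_iff hα.ne', mul_comm, mul_rpow_neg_eq_of_hasDerivAt hF' hα]
  have hFβ : deriv F β = (1 + (1 - (d : ℝ) / 2) * (F β - F 1)) / β := by
    rw [(hF' β hβ).deriv, eq_div_iff hβ.ne', mul_comm, mul_rpow_neg_eq_of_hasDerivAt hF' hβ]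
  have hF1 : deriv F 1 = 1 := by rw [(hF' 1 one_pos).deriv, Real.one_rpow]
  have hFαα : deriv (deriv F) α = -((d : ℝ) / 2) * deriv F α / α := by
    rw [deriv_deriv_of_hasDerivAt_rpow hF' hα, (hF' α hα).deriv]
  have hgα := (hasDerivAt_add_divided_difference (hF' α hα).differentiableAt.hasDerivAt hα1).deriv
  have hgβ := (hasDerivAt_add_divided_difference (hF' β hβ).differentiableAt.hasDerivAt hβ1).deriv
  have hα1' : α - 1 ≠ 0 := sub_ne_zero.2 hα1
  have hβ1' : β - 1 ≠ 0 := sub_ne_zero.2 hβ1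
  have hαβ : α - β ≠ 0 := sub_ne_zero.2 hne
  obtain ⟨u, hu⟩ : ∃ u, F α = u + F 1 := ⟨F α - F 1, by ring⟩
  obtain ⟨v, hv⟩ : ∃ v, F β = v + F 1 := ⟨F β - F 1, by ring⟩
  simp only [dd4aaccb, dd4aaacb, dd3aacb, dd3accb, dd3aaab, dd3aabb, dd2aab, dd2abb, dd2abc, dd1,
    hgα, hgβ, hFαα, hFα, hFβ, hF1, hsqrt, hu, hv]
  rw [← neg_sub α 1, ← neg_sub β 1]
  simp only [add_sub_cancel_right, sub_add_cancel_right]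
  field_simp
  ring
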